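/- Let (X, d) be a metric space, let α, β, γ, δ, ε, ζ : X×X → ℝ, and let T : X → X be an (α, β, γ, δ, ε, ζ)-weighted generalized pseudocontraction. Suppose there exists λ : X×X → [0,1] such that for all x, y ∈ X: α_λ(x,y) + ζ_λ(x,y) + 2·min{β_λ(x,y), 0} ≥ 0 and δ_λ(x,y) + ε_λ(x,y) + 2·min{β_λ(x,y), 0} > 0. Then every point of X is a fixed point of T, i.e., Tx = x for all x ∈ X. -/

import Mathlib

open Filter Topology

/-- `T` is an `(α, β, γ, δ, ε, ζ)`-weighted generalized pseudocontraction. -/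
def IsWGPseudocontraction {X : Type*} [MetricSpace X]
    (T : X → X) (α β γ δ ε ζ : X → X → ℝ) : Prop :=
  ∀ x y : X,
    α x y * dist (T x) (T y) ^ 2 + β x y * dist x (T y) ^ 2 +
      γ x y * dist (T x) y ^ 2 + δ x y * dist x y ^ 2 +
      ε x y * dist x (T x) ^ 2 + ζ x y * dist y (T y) ^ 2 ≤ 0

/-- The `l`-weighted combination of two coefficient maps:
`(f, g) ↦ (x, y) ↦ (1 − l(x,y))·f(x,y) + l(x,y)·g(y,x)`.
With it: `α_λ = wComb l α α`, `β_λ = wComb l β γ`, `γ_λ = wComb l γ β`,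
`δ_λ = wComb l δ δ`, `ε_λ = wComb l ε ζ`, `ζ_λ = wComb l ζ ε`. -/
def wComb {X : Type*} (l f g : X → X → ℝ) : X → X → ℝ :=
  fun x y => (1 - l x y) * f x y + l x y * g y x

/-- The `l`-weighted average of the defining inequality with its version for `x`, `y` swapped. -/
theorem IsWGPseudocontraction.wComb {X : Type*} [MetricSpace X]
    {T : X → X} {α β γ δ ε ζ l : X → X → ℝ} (hT : IsWGPseudocontraction T α β γ δ ε ζ)
    (hl : ∀ x y, l x y ∈ Set.Icc (0 : ℝ) 1) :
    IsWGPseudocontraction T (wComb l α α) (wComb l β γ) (wComb l γ β)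
      (wComb l δ δ) (wComb l ε ζ) (wComb l ζ ε) := by
  intro x y
  have h₁ := mul_nonpos_of_nonneg_of_nonpos (sub_nonneg.2 (hl x y).2) (hT x y)
  have h₂ := mul_nonpos_of_nonneg_of_nonpos (hl x y).1 (hT y x)
  rw [dist_comm (T y) (T x), dist_comm y (T x), dist_comm (T y) x, dist_comm y x] at h₂
  simp only [_root_.wComb]
  linarith

theorem stmt_11 {X : Type*} [MetricSpace X] (α β γ δ ε ζ : X → X → ℝ)
    (T : X → X) (hT : IsWGPseudocontraction T α β γ δ ε ζ)
    (h : ∃ l : X → X → ℝ, (∀ x y : X, l x y ∈ Set.Icc (0 : ℝ) 1) ∧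
      ∀ x y : X,
        0 ≤ wComb l α α x y + wComb l ζ ε x y + 2 * min (wComb l β γ x y) 0 ∧
        0 < wComb l δ δ x y + wComb l ε ζ x y + 2 * min (wComb l β γ x y) 0) :
    ∀ x : X, T x = x := by
  obtain ⟨l, hl, h⟩ := h
  intro x
  obtain ⟨h₁, h₂⟩ := h x (T x)
  have hx := hT.wComb hl x (T x)
  rw [dist_self] at hx
  by_contra hne
  have ha : 0 < dist x (T x) ^ 2 := by
    have := dist_pos.2 (Ne.symm hne)
    positivity
  have hc : dist x (T (T x)) ^ 2 ≤ 2 * (dist x (T x) ^ 2 + dist (T x) (T (T x)) ^ 2) :=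
    (pow_le_pow_left₀ dist_nonneg (dist_triangle x (T x) (T (T x))) 2).trans add_sq_le
  have hβ := mul_le_mul_of_nonneg_right (min_le_left (wComb l β γ x (T x)) 0)
    (sq_nonneg (dist x (T (T x))))
  have hm := mul_le_mul_of_nonpos_left hc (min_le_right (wComb l β γ x (T x)) 0)
  have hb := mul_nonneg h₁ (sq_nonneg (dist (T x) (T (T x))))
  have hpos := mul_pos h₂ ha
  linarith
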